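/- arXiv:1711.02663 — 3 statements merged into one kernel-verified Lean document; each statement's English description precedes it below -/
import Mathlib

section
/- For every g ∈ G, the set Z_g, viewed as a subset of the Cantor space 2^ω by identifying each A ⊆ ω with its characteristic function, is not an F_σ subset of 2^ω; that is, it is not a countable union of closed subsets of 2^ω. -/
open Filter

/-- `cnt A n` is the cardinality of `A ∩ {0, …, n-1}`. -/
noncomputable def cnt (A : Set ℕ) (n : ℕ) : ℕ := (A ∩ Set.Iio n).ncard

/-- `G` : functions `g : ω → (0,∞)` with `g n → ∞` and `n / g n` not tending to `0`. -/
def inG (g : ℕ → ℝ) : Prop :=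
  (∀ n, 0 < g n) ∧ Tendsto g atTop atTop ∧
    ¬ Tendsto (fun n : ℕ => (n : ℝ) / g n) atTop (nhds 0)

/-- The simple density ideal `Z_g`. -/
def Zg (g : ℕ → ℝ) : Set (Set ℕ) :=
  {A | Tendsto (fun n => (cnt A n : ℝ) / g n) atTop (nhds 0)}

/-- `Z_g` for an `ω`-valued function. -/
def ZgN (g : ℕ → ℕ) : Set (Set ℕ) := Zg (fun n => (g n : ℝ))

/-- `H↑` : nondecreasing members of `G` with values in `ω`. -/
def inHup (f : ℕ → ℕ) : Prop := inG (fun n => (f n : ℝ)) ∧ Monotone f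

lemma cnt_mono_set {A B : Set ℕ} (h : A ⊆ B) (n : ℕ) : cnt A n ≤ cnt B n :=
  Set.ncard_le_ncard (Set.inter_subset_inter_left _ h) ((Set.finite_Iio n).inter_of_right _)

lemma cnt_mono (A : Set ℕ) : Monotone (cnt A) := fun _ n h =>
  Set.ncard_le_ncard (Set.inter_subset_inter_right _ (Set.Iio_subset_Iio h))
    ((Set.finite_Iio n).inter_of_right _)

lemma cnt_le_of_subset_Iio {A : Set ℕ} {m : ℕ} (h : A ⊆ Set.Iio m) (n : ℕ) : cnt A n ≤ m := by
  have := Set.ncard_le_ncard (Set.inter_subset_left.trans h : A ∩ Set.Iio n ⊆ Set.Iio m)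
    (Set.finite_Iio m)
  rwa [Set.ncard_Iio_nat] at this

lemma cnt_union_le (A B : Set ℕ) (n : ℕ) : cnt (A ∪ B) n ≤ cnt A n + cnt B n := by
  unfold cnt
  rw [Set.union_inter_distrib_right]
  exact Set.ncard_union_le _ _

lemma cnt_zero (A : Set ℕ) : cnt A 0 = 0 := by simp [cnt]

lemma cnt_succ_of_mem {A : Set ℕ} {n : ℕ} (h : n ∈ A) : cnt A (n + 1) = cnt A n + 1 := by
  unfold cnt
  have : A ∩ Set.Iio (n + 1) = insert n (A ∩ Set.Iio n) := by
    ext i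
    simp only [Set.mem_inter_iff, Set.mem_Iio, Set.mem_insert_iff]
    grind
  rw [this, Set.ncard_insert_of_notMem (by simp) ((Set.finite_Iio n).inter_of_right _)]

lemma cnt_succ_of_notMem {A : Set ℕ} {n : ℕ} (h : n ∉ A) : cnt A (n + 1) = cnt A n := by
  unfold cnt
  congr 1
  ext i
  simp only [Set.mem_inter_iff, Set.mem_Iio]
  grind

lemma cnt_congr {A B : Set ℕ} {m n : ℕ} (h : ∀ i < m, (i ∈ A ↔ i ∈ B)) (hn : n ≤ m) :
    cnt A n = cnt B n := by
  unfold cnt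
  congr 1
  ext i
  simp only [Set.mem_inter_iff, Set.mem_Iio]
  grind

/-- Sets may be built greedily: whether `n` is put in depends on the number of earlier elements. -/
lemma exists_mem_iff_cnt (P : ℕ → ℕ → Prop) : ∃ B : Set ℕ, ∀ n, n ∈ B ↔ P n (cnt B n) := by
  classical
  let c : ℕ → ℕ := fun n => Nat.rec 0 (fun k v => if P k v then v + 1 else v) n
  have hc : ∀ n, c (n + 1) = if P n (c n) then c n + 1 else c n := fun n => rfl
  let B : Set ℕ := {n | P n (c n)}
  have h : ∀ n, cnt B n = c n := by
    intro n
    induction n with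
    | zero => exact cnt_zero B
    | succ n ih =>
      rw [hc]
      split_ifs with hP
      · rw [cnt_succ_of_mem (show n ∈ B from hP), ih]
      · rw [cnt_succ_of_notMem (show n ∉ B from hP), ih]
  exact ⟨B, fun n => by rw [h]; rfl⟩

/-- Arbitrarily far out there are sets of arbitrarily small `g`-density supremum outside `Z_g`. -/
lemma exists_notMem_Zg_cnt_le {g : ℕ → ℝ} (hg : inG g) (m : ℕ) {δ : ℝ} (hδ : 0 < δ) :
    ∃ B : Set ℕ, B ∉ Zg g ∧ (∀ i ∈ B, m ≤ i) ∧ ∀ n, (cnt B n : ℝ) ≤ δ * g n := by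
  obtain ⟨hpos, htop, hnot⟩ := hg
  obtain ⟨B, hB⟩ := exists_mem_iff_cnt fun n c => m ≤ n ∧ ∀ k > n, (c : ℝ) + 1 ≤ δ * g k
  have hle : ∀ n, ∀ k ≥ n, (cnt B n : ℝ) ≤ δ * g k := by
    intro n
    induction n with
    | zero =>
      intro k _
      rw [cnt_zero]
      have := hpos k
      push_cast
      positivity
    | succ n ih =>
      intro k hk
      by_cases hn : n ∈ B
      · rw [cnt_succ_of_mem hn]
        push_cast
        exact ((hB n).1 hn).2 k hk
      · rw [cnt_succ_of_notMem hn]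
        exact ih k (by omega)
  refine ⟨B, fun hZ => ?_, fun i hi => ((hB i).1 hi).1, fun n => hle n n le_rfl⟩
  have hZ : Tendsto (fun n => (cnt B n : ℝ) / g n) atTop (nhds 0) := hZ
  have hconst : ∀ C : ℝ, Tendsto (fun n => ((cnt B n : ℝ) + C) / g n) atTop (nhds 0) := by
    intro C
    simpa [add_div] using hZ.add (htop.const_div_atTop C)
  obtain ⟨M, hM⟩ := eventually_atTop.1 ((hconst 1).eventually_lt_const hδ)
  have hmem : ∀ n ≥ max m M, n ∈ B := by
    intro n hn
    refine (hB n).2 ⟨le_of_max_le_left hn, fun k hk => ?_⟩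
    have h1 := hM k ((le_of_max_le_right hn).trans hk.le)
    rw [div_lt_iff₀ (hpos k)] at h1
    have h2 : (cnt B n : ℝ) ≤ cnt B k := by exact_mod_cast cnt_mono B hk.le
    linarith
  have hlow : ∀ n, n ≤ cnt B n + max m M := by
    intro n
    induction n with
    | zero => omega
    | succ n ih =>
      rcases le_or_gt (max m M) n with h | h
      · rw [cnt_succ_of_mem (hmem n h)]
        omega
      · omega
  refine hnot (squeeze_zero (fun n => ?_) (fun n => ?_) (hconst (max m M : ℕ)))
  · have := hpos n
    positivity
  · have := hpos n
    gcongr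
    exact_mod_cast hlow n

open Classical in
/-- The characteristic function of a set of naturals, as a point of the Cantor space. -/
noncomputable def cantorPoint (A : Set ℕ) : ℕ → Bool := fun i => decide (i ∈ A)

lemma exists_agree_notMem_of_isClosed {F : Set (ℕ → Bool)} (hF : IsClosed F) {A : Set ℕ}
    (hA : cantorPoint A ∉ F) :
    ∃ N, ∀ A' : Set ℕ, (∀ i < N, (i ∈ A' ↔ i ∈ A)) → cantorPoint A' ∉ F := by
  obtain ⟨I, u, hu, hsub⟩ := isOpen_pi_iff.1 hF.isOpen_compl _ hA
  refine ⟨I.sup id + 1, fun A' h => hsub fun i hi => ?_⟩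
  have hiN : i < I.sup id + 1 := Nat.lt_succ_of_le (Finset.le_sup (f := id) hi)
  have : cantorPoint A' i = cantorPoint A i := by simp [cantorPoint, h i hiN]
  rw [this]
  exact (hu i hi).2

/-- A finite set has an end-extension of small additional density that decides against a closed
subset of `Z_g`. -/
lemma exists_extension_avoiding {g : ℕ → ℝ} (hg : inG g) {F : Set (ℕ → Bool)} (hF : IsClosed F)
    (hFZ : ∀ A, cantorPoint A ∈ F → A ∈ Zg g) {δ : ℝ} (hδ : 0 < δ) (s : Set ℕ) (m : ℕ) :
    ∃ (t : Set ℕ) (m' : ℕ), t ⊆ Set.Iio m' ∧ m < m' ∧ (∀ i < m, (i ∈ t ↔ i ∈ s)) ∧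
      (∀ n, (cnt t n : ℝ) ≤ cnt s n + δ * g n) ∧
      ∀ A : Set ℕ, (∀ i < m', (i ∈ A ↔ i ∈ t)) → cantorPoint A ∉ F := by
  obtain ⟨B, hBZ, hBm, hBle⟩ := exists_notMem_Zg_cnt_le hg m hδ
  have hZ : s ∪ B ∉ Zg g := by
    refine fun h => hBZ (squeeze_zero (fun n => ?_) (fun n => ?_) h)
    · have := hg.1 n
      positivity
    · have := hg.1 n
      gcongr
      exact cnt_mono_set Set.subset_union_right n
  obtain ⟨N, hN⟩ := exists_agree_notMem_of_isClosed hF fun h => hZ (hFZ _ h)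
  refine ⟨(s ∪ B) ∩ Set.Iio (max N (m + 1)), max N (m + 1), Set.inter_subset_right, by simp,
    fun i hi => ?_, fun n => ?_, fun A hA => hN A fun i hi => ?_⟩
  · have h1 : i ∉ B := fun h => absurd (hBm i h) (by omega)
    have h2 : i < max N (m + 1) := by omega
    simp [h1, h2]
  · have h1 := (cnt_mono_set (Set.inter_subset_left : (s ∪ B) ∩ Set.Iio (max N (m + 1)) ⊆ _)
      n).trans (cnt_union_le s B n)
    have h2 : (cnt ((s ∪ B) ∩ Set.Iio (max N (m + 1))) n : ℝ) ≤ cnt s n + cnt B n := by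
      exact_mod_cast h1
    linarith [hBle n]
  · have h2 : i < max N (m + 1) := by omega
    rw [hA i h2]
    simp only [Set.mem_inter_iff, Set.mem_Iio, h2, and_true]

/-- The set diagonalizing against countably many closed subsets of `Z_g`. -/
lemma exists_mem_Zg_avoiding {g : ℕ → ℝ} (hg : inG g) {F : ℕ → Set (ℕ → Bool)}
    (hF : ∀ k, IsClosed (F k)) (hFZ : ∀ k A, cantorPoint A ∈ F k → A ∈ Zg g) :
    ∃ A ∈ Zg g, ∀ k, cantorPoint A ∉ F k := by
  choose t' m' hsub hlt hext hcnt havoid using fun (k : ℕ) (p : Set ℕ × ℕ) =>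
    exists_extension_avoiding hg (hF k) (hFZ k)
      (pow_pos (half_pos one_pos) k : (0 : ℝ) < (1 / 2) ^ k) p.1 p.2
  let q : ℕ → Set ℕ × ℕ := fun k => Nat.rec (∅, 0) (fun k p => (t' k p, m' k p)) k
  have hq : ∀ k, (q k).1 ⊆ Set.Iio (q k).2 := by
    rintro (_ | k)
    · exact Set.empty_subset _
    · exact hsub k (q k)
  have hmono : StrictMono fun k => (q k).2 := strictMono_nat_of_lt_succ fun k => hlt k _
  have hagree : ∀ k l, k ≤ l → ∀ i < (q k).2, (i ∈ (q l).1 ↔ i ∈ (q k).1) := by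
    intro k l hkl
    induction l, hkl using Nat.le_induction with
    | base => exact fun i _ => Iff.rfl
    | succ l hkl ih =>
      exact fun i hi => (hext l _ i (hi.trans_le (hmono.monotone hkl))).trans (ih i hi)
  have hbound : ∀ n k l, k ≤ l →
      (cnt (q l).1 n : ℝ) ≤ cnt (q k).1 n + (2 * (1 / 2) ^ k - 2 * (1 / 2) ^ l) * g n := by
    intro n k l hkl
    induction l, hkl using Nat.le_induction with
    | base => simp
    | succ l hkl ih =>
      have h : (cnt (q (l + 1)).1 n : ℝ) ≤ cnt (q l).1 n + (1 / 2) ^ l * g n :=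
        hcnt l _ n
      rw [pow_succ]
      linarith
  have hA : ∀ k, ∀ i < (q k).2, (i ∈ ⋃ l, (q l).1) ↔ i ∈ (q k).1 := by
    intro k i hi
    refine ⟨fun h => ?_, fun h => Set.mem_iUnion_of_mem k h⟩
    obtain ⟨l, hl⟩ := Set.mem_iUnion.1 h
    rcases le_total k l with hkl | hkl
    · exact (hagree k l hkl i hi).1 hl
    · exact (hagree l k hkl i (hq l hl)).2 hl
  have hupper : ∀ k n, (cnt (⋃ l, (q l).1) n : ℝ) / g n ≤ (q k).2 / g n + 2 * (1 / 2) ^ k := by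
    intro k n
    have hgn := hg.1 n
    have h1 : n ≤ (q (max k n)).2 := (le_max_right k n).trans hmono.le_apply
    have h2 := hbound n k (max k n) (le_max_left k n)
    rw [← cnt_congr (hA _) h1] at h2
    have h3 : (cnt (q k).1 n : ℝ) ≤ (q k).2 := by exact_mod_cast cnt_le_of_subset_Iio (hq k) n
    have h4 : 0 ≤ 2 * (1 / 2 : ℝ) ^ max k n * g n := by positivity
    rw [div_add' _ _ _ hgn.ne', div_le_div_iff_of_pos_right hgn]
    linarith
  refine ⟨⋃ l, (q l).1, ?_, fun k => havoid k _ _ (hA (k + 1))⟩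
  refine tendsto_order.2 ⟨fun a ha => Eventually.of_forall fun n => ?_, fun ε hε => ?_⟩
  · have := hg.1 n
    exact ha.trans_le (by positivity)
  · obtain ⟨k, hk⟩ := exists_pow_lt_of_lt_one (half_pos hε) (by norm_num : (1 / 2 : ℝ) < 1)
    have hlim : Tendsto (fun n => ((q k).2 : ℝ) / g n + 2 * (1 / 2) ^ k) atTop
        (nhds (0 + 2 * (1 / 2) ^ k)) := (hg.2.1.const_div_atTop _).add_const _
    filter_upwards [hlim.eventually_lt_const (show 0 + 2 * (1 / 2 : ℝ) ^ k < ε by linarith)]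
      with n hn using (hupper k n).trans_lt hn

/-- For every `g ∈ G`, the ideal `Z_g`, viewed as a subset of the Cantor space `2^ω`,
is not an `F_σ` subset. -/
theorem Zg_not_Fsigma (g : ℕ → ℝ) (hg : inG g) :
    ¬ ∃ F : ℕ → Set (ℕ → Bool), (∀ n, IsClosed (F n)) ∧
      {x : ℕ → Bool | {i | x i = true} ∈ Zg g} = ⋃ n, F n := by
  rintro ⟨F, hF, hU⟩
  have hiff : ∀ A, A ∈ Zg g ↔ ∃ k, cantorPoint A ∈ F k := by
    intro A
    have h := Set.ext_iff.1 hU (cantorPoint A)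
    simpa [cantorPoint] using h
  obtain ⟨A, hA, hav⟩ := exists_mem_Zg_avoiding hg hF fun k A h => (hiff A).2 ⟨k, h⟩
  obtain ⟨k, hk⟩ := (hiff A).1 hA
  exact hav k hk
end

section
/- Let f ∈ H↑. If there exist a strictly increasing sequence (n_k) of natural numbers and l ∈ ω such that f(n_k + l)/f(n_k) → ∞ as k → ∞, then the quotient set S_f has cardinality 𝔠 (the cardinality of the continuum). -/
open Filter

open scoped ENNReal

/-- The relation `R`: `g R h` iff `limsup g(n)/h(n) < ∞` and `limsup h(n)/g(n) < ∞`. -/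
def Rrel (g h : ℕ → ℕ) : Prop :=
  limsup (fun n => (g n : ℝ≥0∞) / (h n : ℝ≥0∞)) atTop < ⊤ ∧
  limsup (fun n => (h n : ℝ≥0∞) / (g n : ℝ≥0∞)) atTop < ⊤

/-- `S_f` : the quotient of `{g ∈ H↑ : Z_f = Z_g}` by the relation `R`. -/
def Sf (f : ℕ → ℕ) : Type :=
  Quot (fun g h : {g : ℕ → ℕ // inHup g ∧ ZgN g = ZgN f} => Rrel g.1 h.1)

lemma cnt_add_le (A : Set ℕ) (m l : ℕ) : cnt A (m + l) ≤ cnt A m + l := by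
  have hsub : A ∩ Set.Iio (m + l) ⊆ (A ∩ Set.Iio m) ∪ Set.Ico m (m + l) := by
    rintro a ⟨haA, ha⟩
    rcases lt_or_ge a m with h | h
    · exact Or.inl ⟨haA, h⟩
    · exact Or.inr ⟨h, ha⟩
  calc cnt A (m + l) ≤ ((A ∩ Set.Iio m) ∪ Set.Ico m (m + l)).ncard :=
        Set.ncard_le_ncard hsub
          (((Set.finite_Iio m).inter_of_right A).union (Set.finite_Ico m (m + l)))
    _ ≤ (A ∩ Set.Iio m).ncard + (Set.Ico m (m + l)).ncard := Set.ncard_union_le _ _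
    _ = cnt A m + l := by
        rw [← Finset.coe_Ico, Set.ncard_coe_finset, Nat.card_Ico, Nat.add_sub_cancel_left, cnt]

/-- If `u` grows by at most `l` over each window of length `l`, then `u / g → 0` passes to any `f`
that dominates the shift of `g` by `l`. -/
lemma tendsto_div_of_shift_le {f g u : ℕ → ℕ} {l : ℕ} (hgpos : ∀ m, 0 < g m)
    (hg : Tendsto (fun m => (g m : ℝ)) atTop atTop) (hgf : ∀ m, g m ≤ f (m + l))
    (hu : ∀ m, u (m + l) ≤ u m + l)
    (h : Tendsto (fun m => (u m : ℝ) / (g m : ℝ)) atTop (nhds 0)) :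
    Tendsto (fun m => (u m : ℝ) / (f m : ℝ)) atTop (nhds 0) := by
  rw [← tendsto_add_atTop_iff_nat l]
  have hsum : Tendsto (fun m => (u m : ℝ) / (g m : ℝ) + (l : ℝ) / (g m : ℝ)) atTop (nhds 0) := by
    simpa using h.add (hg.const_div_atTop (l : ℝ))
  refine squeeze_zero (fun m => by positivity) (fun m => ?_) hsum
  have hpos : (0 : ℝ) < g m := by exact_mod_cast hgpos m
  have hle : (g m : ℝ) ≤ f (m + l) := by exact_mod_cast hgf m
  have hu' : (u (m + l) : ℝ) ≤ u m + l := by exact_mod_cast hu m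
  rw [← add_div]
  gcongr

lemma tendsto_div_of_le {f g u : ℕ → ℕ} (hfpos : ∀ m, 0 < f m) (hfg : ∀ m, f m ≤ g m)
    (h : Tendsto (fun m => (u m : ℝ) / (f m : ℝ)) atTop (nhds 0)) :
    Tendsto (fun m => (u m : ℝ) / (g m : ℝ)) atTop (nhds 0) := by
  refine squeeze_zero (fun m => by positivity) (fun m => ?_) h
  have hpos : (0 : ℝ) < f m := by exact_mod_cast hfpos m
  have hle : (f m : ℝ) ≤ g m := by exact_mod_cast hfg m
  gcongr

lemma inHup.pos {f : ℕ → ℕ} (hf : inHup f) (m : ℕ) : 0 < f m :=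
  Nat.cast_pos.1 (hf.1.1 m)

/-- A nondecreasing function between `f` and its shift by `l` is in `H↑` and has the same ideal. -/
lemma inHup.of_le_shift {f g : ℕ → ℕ} {l : ℕ} (hf : inHup f) (hg : Monotone g)
    (hfg : ∀ m, f m ≤ g m) (hgf : ∀ m, g m ≤ f (m + l)) : inHup g ∧ ZgN g = ZgN f := by
  have hgpos : ∀ m, 0 < g m := fun m => (hf.pos m).trans_le (hfg m)
  have hgtop : Tendsto (fun m => (g m : ℝ)) atTop atTop :=
    tendsto_atTop_mono (fun m => by exact_mod_cast hfg m) hf.1.2.1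
  refine ⟨⟨⟨fun m => Nat.cast_pos.2 (hgpos m), hgtop, fun h => hf.1.2.2 ?_⟩, hg⟩, ?_⟩
  · exact tendsto_div_of_shift_le (u := id) hgpos hgtop hgf (fun m => le_rfl) h
  · ext A
    exact ⟨tendsto_div_of_shift_le hgpos hgtop hgf (fun m => cnt_add_le A m l),
      tendsto_div_of_le hf.pos hfg⟩

open Classical in
/-- The function `f` raised to the value `f (j + l)` on each window `[j, j + l]` with `j ∈ S`. -/
noncomputable def raise (f : ℕ → ℕ) (l : ℕ) (S : Set ℕ) (m : ℕ) : ℕ :=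
  f m ⊔ ((Finset.Icc (m - l) m).filter (· ∈ S)).sup (fun j => f (j + l))

section raise

variable {f : ℕ → ℕ} {l : ℕ} {S : Set ℕ}

lemma le_raise (m : ℕ) : f m ≤ raise f l S m := le_sup_left

lemma raise_le (hf : Monotone f) (m : ℕ) : raise f l S m ≤ f (m + l) := by
  refine sup_le (hf (Nat.le_add_right m l)) (Finset.sup_le fun j hj => hf ?_)
  simp only [Finset.mem_filter, Finset.mem_Icc] at hj
  omega

lemma shift_le_raise {j m : ℕ} (hj : j ∈ S) (hjm : j ≤ m) (hmj : m ≤ j + l) :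
    f (j + l) ≤ raise f l S m := by
  refine le_sup_of_le_right (Finset.le_sup (f := fun j => f (j + l)) ?_)
  simp only [Finset.mem_filter, Finset.mem_Icc]
  exact ⟨⟨by omega, hjm⟩, hj⟩

lemma monotone_raise (hf : Monotone f) : Monotone (raise f l S) := by
  intro m m' hm
  refine sup_le ((hf hm).trans (le_raise m')) (Finset.sup_le fun j hj => ?_)
  simp only [Finset.mem_filter, Finset.mem_Icc] at hj
  rcases le_total m' (j + l) with h | h
  · exact shift_le_raise hj.2 (hj.1.2.trans hm) h
  · exact (hf h).trans (le_raise m')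

lemma raise_eq_shift (hf : Monotone f) {m : ℕ} (hm : m ∈ S) : raise f l S m = f (m + l) :=
  (raise_le hf m).antisymm (shift_le_raise hm le_rfl (Nat.le_add_right m l))

lemma raise_eq_self {m : ℕ} (h : ∀ j ∈ S, j ≤ m → j + l < m) : raise f l S m = f m := by
  refine (sup_le le_rfl (Finset.sup_le fun j hj => ?_)).antisymm (le_raise m)
  simp only [Finset.mem_filter, Finset.mem_Icc] at hj
  have := h j hj.2 hj.1.2
  omega

end raise

/-- Eventual comparability up to a constant factor. -/
def Comparable (g h : ℕ → ℕ) : Prop :=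
  ∃ C : ℕ, ∀ᶠ m in atTop, g m ≤ C * h m ∧ h m ≤ C * g m

lemma comparable_equivalence : Equivalence Comparable where
  refl g := ⟨1, Eventually.of_forall fun m => by simp⟩
  symm := fun ⟨C, hC⟩ => ⟨C, hC.mono fun _ => And.symm⟩
  trans := by
    rintro g h k ⟨C, hC⟩ ⟨D, hD⟩
    refine ⟨C * D, ?_⟩
    filter_upwards [hC, hD] with m hm hm'
    constructor
    · rw [mul_assoc]
      exact hm.1.trans (Nat.mul_le_mul_left C hm'.1)
    · rw [mul_comm C, mul_assoc]
      exact hm'.2.trans (Nat.mul_le_mul_left D hm.2)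

lemma exists_eventually_le_mul_of_limsup_lt_top {g h : ℕ → ℕ} (hh : ∀ m, 0 < h m)
    (hlim : limsup (fun m => (g m : ℝ≥0∞) / (h m : ℝ≥0∞)) atTop < ⊤) :
    ∃ C : ℕ, ∀ᶠ m in atTop, g m ≤ C * h m := by
  obtain ⟨C, hC⟩ := ENNReal.exists_nat_gt hlim.ne
  refine ⟨C, (eventually_lt_of_limsup_lt hC).mono fun m hm => ?_⟩
  have hle := (ENNReal.div_le_iff (by exact_mod_cast (hh m).ne')
    (ENNReal.natCast_ne_top (h m))).1 hm.le
  exact_mod_cast hle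

lemma Rrel.comparable {g h : ℕ → ℕ} (hg : ∀ m, 0 < g m) (hh : ∀ m, 0 < h m) (hR : Rrel g h) :
    Comparable g h := by
  obtain ⟨C, hC⟩ := exists_eventually_le_mul_of_limsup_lt_top hh hR.1
  obtain ⟨D, hD⟩ := exists_eventually_le_mul_of_limsup_lt_top hg hR.2
  refine ⟨max C D, ?_⟩
  filter_upwards [hC, hD] with m hm hm'
  exact ⟨hm.trans (Nat.mul_le_mul_right _ (le_max_left C D)),
    hm'.trans (Nat.mul_le_mul_right _ (le_max_right C D))⟩

lemma comparable_of_quot_mk_eq {f : ℕ → ℕ} {g h : {g : ℕ → ℕ // inHup g ∧ ZgN g = ZgN f}}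
    (hgh : (Quot.mk _ g : Sf f) = Quot.mk _ h) : Comparable g.1 h.1 :=
  ((comparable_equivalence.comap Subtype.val).eqvGen_iff).1
    ((Quot.eqvGen_exact hgh).mono fun a b => Rrel.comparable a.2.1.pos b.2.1.pos)

/-- A code for the first `k` bits of `x`. -/
def prefixCode (x : ℕ → Bool) (k : ℕ) : ℕ := Encodable.encode ((List.range k).map x)

lemma prefixCode_eq {x y : ℕ → Bool} {j k : ℕ} (h : prefixCode x j = prefixCode y k) :
    j = k ∧ ∀ i < j, x i = y i := by
  have hmap := Encodable.encode_injective h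
  obtain rfl : j = k := by simpa using congrArg List.length hmap
  exact ⟨rfl, fun i hi => List.map_inj_left.1 hmap i (List.mem_range.2 hi)⟩

lemma tendsto_prefixCode (x : ℕ → Bool) : Tendsto (prefixCode x) atTop atTop := by
  have hinj : Function.Injective (prefixCode x) := fun _ _ h => (prefixCode_eq h).1
  exact hinj.nat_tendsto_atTop

lemma not_comparable_raise {f : ℕ → ℕ} (hf : inHup f) {p : ℕ → ℕ} {l : ℕ}
    (hp : ∀ a b, a < b → p a + l < p b)
    (h : Tendsto (fun k => (f (p k + l) : ℝ) / (f (p k) : ℝ)) atTop atTop)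
    {x y : ℕ → Bool} (hxy : x ≠ y) :
    ¬ Comparable (raise f l (Set.range (p ∘ prefixCode x)))
      (raise f l (Set.range (p ∘ prefixCode y))) := by
  rintro ⟨C, hC⟩
  obtain ⟨i, hi⟩ := Function.ne_iff.1 hxy
  have hptop : Tendsto p atTop atTop :=
    StrictMono.tendsto_atTop fun a b hab => (Nat.le_add_right _ _).trans_lt (hp a b hab)
  obtain ⟨k, hk, hkC, hik⟩ := (((hptop.comp (tendsto_prefixCode x)).eventually hC).and
    (((h.comp (tendsto_prefixCode x)).eventually_gt_atTop (C : ℝ)).and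
      (eventually_gt_atTop i))).exists
  have hle := hk.1
  simp only [Function.comp_apply] at hle hkC
  have hmem : p (prefixCode x k) ∈ Set.range (p ∘ prefixCode x) := ⟨k, rfl⟩
  rw [raise_eq_shift hf.2 hmem, raise_eq_self] at hle
  · have hpos : (0 : ℝ) < f (p (prefixCode x k)) := by exact_mod_cast hf.pos _
    rw [lt_div_iff₀ hpos] at hkC
    exact absurd hkC (not_lt.2 (by exact_mod_cast hle))
  · rintro _ ⟨j, rfl⟩ hj
    simp only [Function.comp_apply] at hj ⊢
    rcases lt_trichotomy (prefixCode y j) (prefixCode x k) with hlt | heq | hgt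
    · exact hp _ _ hlt
    · exact absurd ((prefixCode_eq heq.symm).2 i hik) hi
    · have := hp _ _ hgt
      omega

/-- If there are a strictly increasing sequence `(n_k)` and `l ∈ ω` with
`f(n_k + l)/f(n_k) → ∞`, then `S_f` has cardinality `𝔠`. -/
theorem card_Sf_eq_continuum_of_jump (f : ℕ → ℕ) (hf : inHup f)
    (n : ℕ → ℕ) (hn : StrictMono n) (l : ℕ)
    (h : Tendsto (fun k => (f (n k + l) : ℝ) / (f (n k) : ℝ)) atTop atTop) :
    Cardinal.mk (Sf f) = Cardinal.continuum := by
  refine le_antisymm ?_ ?_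
  · calc Cardinal.mk (Sf f) ≤ Cardinal.mk {g : ℕ → ℕ // inHup g ∧ ZgN g = ZgN f} :=
          Cardinal.mk_le_of_surjective Quot.mk_surjective
      _ ≤ Cardinal.mk (ℕ → ℕ) := Cardinal.mk_subtype_le _
      _ = Cardinal.continuum := by simp
  · have hp : ∀ a b, a < b → n ((l + 1) * a) + l < n ((l + 1) * b) := by
      intro a b hab
      have hle : (l + 1) * a + (l + 1) ≤ (l + 1) * b := by
        rw [← Nat.mul_succ]
        exact Nat.mul_le_mul_left _ hab
      have hadd := hn.add_le_nat (l + 1) ((l + 1) * a)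
      have hmono := hn.monotone hle
      rw [add_comm (l + 1) ((l + 1) * a)] at hadd
      omega
    have hmul : Tendsto (fun k => (l + 1) * k) atTop atTop :=
      tendsto_id.const_mul_atTop' l.succ_pos
    let F : (ℕ → Bool) → Sf f := fun x =>
      Quot.mk _ ⟨raise f l (Set.range ((fun k => n ((l + 1) * k)) ∘ prefixCode x)),
        hf.of_le_shift (monotone_raise hf.2) le_raise (raise_le hf.2)⟩
    have hF : Function.Injective F := by
      intro x y hxy
      by_contra hne
      exact not_comparable_raise hf hp (h.comp hmul) hne (comparable_of_quot_mk_eq hxy)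
    simpa using Cardinal.mk_le_of_injective hF
end

section
/- There exists a family F ⊆ H of cardinality 𝔠 such that for any two distinct f, g ∈ F, the ideals Z_f and Z_g are incomparable in the Katětov order, i.e., Z_f ≰_K Z_g and Z_g ≰_K Z_f. -/
open Filter

/-- `H = G ∩ ω^ω`. -/
def inH (f : ℕ → ℕ) : Prop := inG (fun n => (f n : ℝ))

/-- The Katětov order on ideals on `ω`. -/
def KatLE (I J : Set (Set ℕ)) : Prop := ∃ φ : ℕ → ℕ, ∀ A ∈ I, φ ⁻¹' A ∈ J

/-- A rapidly growing sequence: `scale 0 = 2` and `scale (n + 1) = scale n ^ 3`. -/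
@[irreducible]
def scale (n : ℕ) : ℕ := 2 ^ 3 ^ n

lemma scale_succ (n : ℕ) : scale (n + 1) = scale n ^ 3 := by
  rw [scale, scale, ← pow_mul, pow_succ]

lemma scale_strictMono : StrictMono scale := fun _ _ h => by
  rw [scale, scale]
  exact Nat.pow_lt_pow_right (by norm_num) (Nat.pow_lt_pow_right (by norm_num) h)

lemma add_two_le_scale (n : ℕ) : n + 2 ≤ scale n := by
  induction n with
  | zero => norm_num [scale]
  | succ n ih => have := scale_strictMono (Nat.lt_succ_self n); grind

lemma scale_pos (n : ℕ) : 0 < scale n := by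
  have := add_two_le_scale n; omega

lemma sq_le_scale (n : ℕ) : (n + 1) ^ 2 ≤ scale n := by
  induction n with
  | zero => norm_num [scale]
  | succ n ih =>
    have h := add_two_le_scale n
    rw [scale_succ]
    calc (n + 1 + 1) ^ 2 ≤ scale n ^ 2 := Nat.pow_le_pow_left h 2
      _ ≤ scale n ^ 3 := Nat.pow_le_pow_right (scale_pos n) (by norm_num)

lemma exists_le_scale_succ (m : ℕ) : ∃ n, m ≤ scale (n + 1) :=
  ⟨m, by have := add_two_le_scale (m + 1); omega⟩

/-- The least `n` with `m ≤ scale (n + 1)`. -/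
def level (m : ℕ) : ℕ := Nat.find (exists_le_scale_succ m)

lemma le_scale_level (m : ℕ) : m ≤ scale (level m + 1) :=
  Nat.find_spec (exists_le_scale_succ m)

lemma level_scale_succ (k : ℕ) : level (scale (k + 1)) = k := by
  refine le_antisymm (Nat.find_min' _ le_rfl) ?_
  have := scale_strictMono.le_iff_le.1 (le_scale_level (scale (k + 1)))
  omega

lemma tendsto_level : Tendsto level atTop atTop := by
  refine tendsto_atTop.2 fun b => ?_
  filter_upwards [eventually_gt_atTop (scale b)] with m hm
  have := scale_strictMono.lt_iff_lt.1 (hm.trans_le (le_scale_level m))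
  omega

open Classical in
/-- The step function equal to `scale n` on the `n`-th block if `n ∈ X`, and to `scale (n + 1)`
otherwise. -/
noncomputable def stepFun (X : Set ℕ) (m : ℕ) : ℕ :=
  if level m ∈ X then scale (level m) else scale (level m + 1)

lemma scale_level_le_stepFun (X : Set ℕ) (m : ℕ) : scale (level m) ≤ stepFun X m := by
  unfold stepFun
  split_ifs
  · exact le_rfl
  · exact scale_strictMono.monotone (Nat.le_succ _)

lemma stepFun_pos (X : Set ℕ) (m : ℕ) : 0 < stepFun X m :=
  (scale_pos _).trans_le (scale_level_le_stepFun X m)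

lemma stepFun_scale_succ_le (X : Set ℕ) (k : ℕ) :
    stepFun X (scale (k + 1)) ≤ scale (k + 1) := by
  unfold stepFun
  rw [level_scale_succ]
  split_ifs
  · exact scale_strictMono.monotone (Nat.le_succ _)
  · exact le_rfl

lemma tendsto_scale_succ : Tendsto (fun k => scale (k + 1)) atTop atTop :=
  scale_strictMono.tendsto_atTop.comp (tendsto_add_atTop_nat 1)

lemma inH_stepFun (X : Set ℕ) : inH (stepFun X) := by
  refine ⟨fun n => Nat.cast_pos.2 (stepFun_pos X n), ?_, fun h => ?_⟩
  · exact tendsto_natCast_atTop_atTop.comp (tendsto_atTop_mono (scale_level_le_stepFun X)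
      (scale_strictMono.tendsto_atTop.comp tendsto_level))
  · obtain ⟨k, hk⟩ := ((h.comp tendsto_scale_succ).eventually_lt_const one_pos).exists
    have hpos : (0 : ℝ) < stepFun X (scale (k + 1)) := by exact_mod_cast stepFun_pos X _
    simp only [Function.comp_apply, div_lt_one hpos, Nat.cast_lt] at hk
    exact hk.not_ge (stepFun_scale_succ_le X k)

lemma card_le_cnt {E : Finset ℕ} {A : Set ℕ} {m : ℕ} (h : ∀ x ∈ E, x ∈ A ∧ x < m) :
    E.card ≤ cnt A m := by
  rw [← Set.ncard_coe_finset]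
  exact Set.ncard_le_ncard (fun x hx => h x hx) ((Set.finite_Iio m).inter_of_right A)

lemma cnt_le_card {E : Finset ℕ} {A : Set ℕ} {m : ℕ} (h : ∀ x ∈ A, x < m → x ∈ E) :
    cnt A m ≤ E.card := by
  rw [← Set.ncard_coe_finset]
  exact Set.ncard_le_ncard (fun x hx => h x hx.1 hx.2) E.finite_toSet

lemma cnt_mono_s11 {A B : Set ℕ} (h : A ⊆ B) (m : ℕ) : cnt A m ≤ cnt B m :=
  Set.ncard_le_ncard (Set.inter_subset_inter_left _ h) ((Set.finite_Iio m).inter_of_right B)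

lemma cnt_fiber_le (φ : ℕ → ℕ) {A : Set ℕ} {p : ℕ} (hp : p ∈ A) (m : ℕ) :
    cnt (φ ⁻¹' {p}) m ≤ cnt (φ ⁻¹' A) m :=
  cnt_mono_s11 (Set.preimage_mono (Set.singleton_subset_iff.2 hp)) m

lemma mem_ZgN_stepFun {X A : Set ℕ} (h : ∀ m, cnt A m * (level m + 1) ≤ stepFun X m) :
    A ∈ ZgN (stepFun X) := by
  refine squeeze_zero (fun m => by positivity) (fun m => ?_)
    ((tendsto_one_div_add_atTop_nhds_zero_nat (𝕜 := ℝ)).comp tendsto_level)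
  have hpos : (0 : ℝ) < stepFun X m := by exact_mod_cast stepFun_pos X m
  rw [Function.comp_apply, div_le_div_iff₀ hpos (by positivity), one_mul]
  exact_mod_cast h m

lemma eventually_cnt_lt_of_mem_ZgN {Y B : Set ℕ} (h : B ∈ ZgN (stepFun Y)) :
    ∀ᶠ k in atTop, k ∈ Y → cnt B (scale (k + 1)) < scale k := by
  have h' : Tendsto (fun n => (cnt B n : ℝ) / (stepFun Y n : ℝ)) atTop (nhds 0) := h
  filter_upwards [(h'.comp tendsto_scale_succ).eventually_lt_const one_pos] with k hk hkY
  have hpos : (0 : ℝ) < stepFun Y (scale (k + 1)) := by exact_mod_cast stepFun_pos Y _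
  simp only [Function.comp_apply, div_lt_one hpos, Nat.cast_lt] at hk
  rwa [stepFun, level_scale_succ, if_pos hkY] at hk

lemma mem_ZgN_of_finite {X A : Set ℕ} (hA : A.Finite) : A ∈ ZgN (stepFun X) := by
  have h : Tendsto (fun n => (stepFun X n : ℝ)) atTop atTop := (inH_stepFun X).2.1
  refine squeeze_zero (fun m => by positivity) (fun m => ?_)
    (h.const_div_atTop (hA.toFinset.card : ℝ))
  gcongr
  exact cnt_le_card fun x hx _ => hA.mem_toFinset.2 hx

lemma range_mem_ZgN {X : Set ℕ} {p : ℕ → ℕ} (hp : ∀ i, scale i ≤ p i) :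
    Set.range p ∈ ZgN (stepFun X) := by
  refine mem_ZgN_stepFun fun m => ?_
  have hcnt : cnt (Set.range p) m ≤ level m + 1 := by
    refine (cnt_le_card (E := (Finset.range (level m + 1)).image p) ?_).trans
      (Finset.card_image_le.trans (Finset.card_range _).le)
    rintro _ ⟨i, rfl⟩ hi
    exact Finset.mem_image_of_mem p (Finset.mem_range.2
      (scale_strictMono.lt_iff_lt.1 (((hp i).trans_lt hi).trans_le (le_scale_level m))))
  calc cnt (Set.range p) m * (level m + 1) ≤ (level m + 1) ^ 2 := by rw [sq]; gcongr
    _ ≤ scale (level m) := sq_le_scale _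
    _ ≤ stepFun X m := scale_level_le_stepFun X m

lemma iUnion_mem_ZgN {X : Set ℕ} {B : ℕ → Finset ℕ} (hX : ∀ k ∈ X, B k = ∅)
    (hcard : ∀ k, (B k).card ≤ scale k) (hB : ∀ k, ∀ x ∈ B k, scale k ≤ x) :
    (⋃ k, (B k : Set ℕ)) ∈ ZgN (stepFun X) := by
  refine mem_ZgN_stepFun fun m => ?_
  have hlt : ∀ k, ∀ x ∈ B k, x < m → k < level m + 1 := fun k x hx hxm =>
    scale_strictMono.lt_iff_lt.1 (((hB k x hx).trans_lt hxm).trans_le (le_scale_level m))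
  have hcnt : ∀ n c, (∀ k, ∀ x ∈ B k, x < m → k < n) → (∀ k < n, scale k ≤ c) →
      cnt (⋃ k, (B k : Set ℕ)) m ≤ n * c := by
    intro n c h hc
    have := (Finset.range n).card_biUnion_le_card_mul B c fun k hk =>
      (hcard k).trans (hc k (Finset.mem_range.1 hk))
    rw [Finset.card_range] at this
    refine (cnt_le_card fun x hx hxm => ?_).trans this
    obtain ⟨k, hk⟩ := Set.mem_iUnion.1 hx
    exact Finset.mem_biUnion.2 ⟨k, Finset.mem_range.2 (h k x hk hxm), hk⟩
  have hmain : ∀ l, cnt (⋃ k, (B k : Set ℕ)) m ≤ (l + 1) * scale l →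
      cnt (⋃ k, (B k : Set ℕ)) m * (l + 2) ≤ scale (l + 1) := by
    intro l h
    have h2 := add_two_le_scale l
    rw [scale_succ]
    calc _ ≤ ((l + 1) * scale l) * (l + 2) := by gcongr
      _ ≤ (scale l * scale l) * scale l := by gcongr; omega
      _ = scale l ^ 3 := by ring
  unfold stepFun
  split_ifs with hmem
  · have hlt' : ∀ k, ∀ x ∈ B k, x < m → k < level m := by
      intro k x hx hxm
      refine lt_of_le_of_ne (Nat.lt_succ_iff.1 (hlt k x hx hxm)) ?_
      rintro rfl
      simp [hX _ hmem] at hx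
    cases hl : level m with
    | zero =>
      have := hcnt 0 0 (hl ▸ hlt') (by simp)
      simp_all
    | succ l =>
      exact hmain l (hcnt _ _ (hl ▸ hlt') fun k hk =>
        scale_strictMono.monotone (Nat.lt_succ_iff.1 hk))
  · refine le_trans (Nat.mul_le_mul_left _ (Nat.le_succ _))
      (hmain (level m) (hcnt _ _ hlt fun k hk =>
        scale_strictMono.monotone (Nat.lt_succ_iff.1 hk)))

/-- On the initial segment of length `scale (k + 1)`, a map `φ` either has a large fibre, or a
large fraction of its values lies above `scale k`. -/
lemma exists_large_fiber_or_image (φ : ℕ → ℕ) (k : ℕ) :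
    (∃ p, scale k ≤ cnt (φ ⁻¹' {p}) (scale (k + 1))) ∨
      ∃ B : Finset ℕ, B.card ≤ scale k ∧ (∀ x ∈ B, scale k ≤ x) ∧
        scale k ≤ cnt (φ ⁻¹' B) (scale (k + 1)) := by
  have hsum := (Finset.range (scale (k + 1))).card_filter_add_card_filter_not
    (fun x => φ x < scale k)
  rw [Finset.card_range, scale_succ] at hsum
  by_cases hbig : scale k ≤ ((Finset.range (scale (k + 1))).filter (¬ φ · < scale k)).card
  · right
    obtain ⟨E, hE, hcard⟩ := Finset.exists_subset_card_eq hbig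
    refine ⟨E.image φ, Finset.card_image_le.trans hcard.le, ?_, ?_⟩
    · simp only [Finset.mem_image]
      rintro _ ⟨x, hx, rfl⟩
      exact not_lt.1 (Finset.mem_filter.1 (hE hx)).2
    · refine hcard.ge.trans (card_le_cnt fun x hx => ⟨?_, ?_⟩)
      · exact Finset.mem_coe.2 (Finset.mem_image_of_mem φ hx)
      · exact Finset.mem_range.1 (Finset.mem_filter.1 (hE hx)).1
  · left
    have hle : scale k * scale k ≤
        ((Finset.range (scale (k + 1))).filter (φ · < scale k)).card := by
      have h2 := add_two_le_scale k
      rw [scale_succ] at hbig ⊢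
      have : scale k * scale k + scale k ≤ scale k ^ 3 := by
        nlinarith [Nat.mul_le_mul h2 h2, sq_nonneg (scale k : ℤ)]
      omega
    obtain ⟨p, -, hp⟩ := Finset.exists_le_card_fiber_of_mul_le_card_of_maps_to
      (t := Finset.range (scale k)) (f := φ) (fun x hx => Finset.mem_range.2
        (Finset.mem_filter.1 hx).2) ⟨0, Finset.mem_range.2 (scale_pos k)⟩
      (by rwa [Finset.card_range])
    refine ⟨p, hp.trans (card_le_cnt fun x hx => ?_)⟩
    simp only [Finset.mem_filter, Finset.mem_range] at hx
    exact ⟨hx.2, hx.1.1⟩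

lemma not_katLE_of_frequently {X Y : Set ℕ} (h : ∃ᶠ k in atTop, k ∈ Y ∧ k ∉ X) :
    ¬ KatLE (ZgN (stepFun X)) (ZgN (stepFun Y)) := by
  rintro ⟨φ, hφ⟩
  by_cases hfib : ∃ᶠ k in atTop, k ∈ Y ∧ ∃ p, scale k ≤ cnt (φ ⁻¹' {p}) (scale (k + 1))
  · have hlarge : ∀ i, ∃ᶠ k in atTop, k ∈ Y ∧ ∃ p, scale i ≤ p ∧
        scale k ≤ cnt (φ ⁻¹' {p}) (scale (k + 1)) := by
      intro i
      refine (hfib.and_eventually (eventually_cnt_lt_of_mem_ZgN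
        (hφ _ (mem_ZgN_of_finite (Set.finite_Iio (scale i)))))).mono ?_
      rintro k ⟨⟨hkY, p, hp⟩, hk⟩
      refine ⟨hkY, p, ?_, hp⟩
      by_contra! hpi
      exact (hp.trans (cnt_fiber_le φ (Set.mem_Iio.2 hpi) _)).not_gt (hk hkY)
    obtain ⟨κ, hκ, hκp⟩ := extraction_forall_of_frequently hlarge
    choose hκY p hp hcnt using hκp
    obtain ⟨i, hi⟩ := (hκ.tendsto_atTop.eventually
      (eventually_cnt_lt_of_mem_ZgN (hφ _ (range_mem_ZgN hp)))).exists
    exact ((hcnt i).trans (cnt_fiber_le φ (Set.mem_range_self i) _)).not_gt (hi (hκY i))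
  · have hB : ∀ k, ∃ B : Finset ℕ, (k ∈ X → B = ∅) ∧ B.card ≤ scale k ∧
        (∀ x ∈ B, scale k ≤ x) ∧
        (k ∉ X → (¬ ∃ p, scale k ≤ cnt (φ ⁻¹' {p}) (scale (k + 1))) →
          scale k ≤ cnt (φ ⁻¹' B) (scale (k + 1))) := by
      intro k
      by_cases hk : k ∉ X ∧ ¬ ∃ p, scale k ≤ cnt (φ ⁻¹' {p}) (scale (k + 1))
      · obtain ⟨B, h1, h2, h3⟩ := (exists_large_fiber_or_image φ k).resolve_left hk.2
        exact ⟨B, fun h => absurd h hk.1, h1, h2, fun _ _ => h3⟩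
      · exact ⟨∅, fun _ => rfl, by simp, by simp, fun h1 h2 => absurd ⟨h1, h2⟩ hk⟩
    choose B hBX hcard hge hcnt using hB
    obtain ⟨k, ⟨⟨hkY, hkX⟩, hk⟩, hlt⟩ := ((h.and_eventually (not_frequently.1 hfib)).and_eventually
      (eventually_cnt_lt_of_mem_ZgN (hφ _ (iUnion_mem_ZgN hBX hcard hge)))).exists
    exact ((hcnt k hkX fun hp => hk ⟨hkY, hp⟩).trans (cnt_mono_s11 (Set.preimage_mono
      (Set.subset_iUnion (fun k => (B k : Set ℕ)) k)) _)).not_gt (hlt hkY)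

/-- The set of codes of the finite prefixes of a binary sequence. -/
def prefixCodes (b : ℕ → Bool) : Set ℕ :=
  Set.range fun n => Encodable.encode ((List.range n).map b)

lemma frequently_mem_prefixCodes_diff {b c : ℕ → Bool} (h : b ≠ c) :
    ∃ᶠ k in atTop, k ∈ prefixCodes b ∧ k ∉ prefixCodes c := by
  obtain ⟨i, hi⟩ := Function.ne_iff.1 h
  have hinj : Function.Injective fun n => Encodable.encode ((List.range n).map b) := by
    intro n n' hn
    simpa using congrArg List.length (Encodable.encode_injective hn)
  refine hinj.nat_tendsto_atTop.frequently (Eventually.frequently ?_)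
  filter_upwards [eventually_gt_atTop i] with n hn
  refine ⟨⟨n, rfl⟩, ?_⟩
  rintro ⟨n', hn'⟩
  have hlist := Encodable.encode_injective hn'
  obtain rfl : n' = n := by simpa using congrArg List.length hlist
  exact hi (List.map_inj_left.1 hlist i (List.mem_range.2 hn)).symm

lemma not_katLE_prefixCodes {b c : ℕ → Bool} (h : b ≠ c) :
    ¬ KatLE (ZgN (stepFun (prefixCodes b))) (ZgN (stepFun (prefixCodes c))) :=
  not_katLE_of_frequently (frequently_mem_prefixCodes_diff h.symm)

lemma katLE_refl (I : Set (Set ℕ)) : KatLE I I := ⟨id, fun _ hA => hA⟩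

lemma stepFun_prefixCodes_injective : Function.Injective fun b => stepFun (prefixCodes b) := by
  intro b c (h : stepFun (prefixCodes b) = stepFun (prefixCodes c))
  by_contra hne
  exact not_katLE_prefixCodes hne (h ▸ katLE_refl _)

/-- There is a family `F ⊆ H` of cardinality `𝔠` whose simple density ideals form an
antichain in the Katětov order. -/
theorem katetov_antichain_of_simple_density_ideals :
    ∃ F : Set (ℕ → ℕ), (∀ f ∈ F, inH f) ∧ Cardinal.mk F = Cardinal.continuum ∧
      ∀ f ∈ F, ∀ g ∈ F, f ≠ g → ¬ KatLE (ZgN f) (ZgN g) ∧ ¬ KatLE (ZgN g) (ZgN f) := by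
  refine ⟨Set.range fun b => stepFun (prefixCodes b), ?_, ?_, ?_⟩
  · rintro _ ⟨b, rfl⟩
    exact inH_stepFun _
  · rw [Cardinal.mk_range_eq _ stepFun_prefixCodes_injective]
    simp
  · rintro _ ⟨b, rfl⟩ _ ⟨c, rfl⟩ hne
    have hbc : b ≠ c := fun h => hne (h ▸ rfl)
    exact ⟨not_katLE_prefixCodes hbc, not_katLE_prefixCodes hbc.symm⟩
end
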